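/- arXiv:1806.10501 — 6 statements merged into one kernel-verified Lean document; each statement's English description precedes it below -/
import Mathlib

section
/- Let H be a bipartite graph with parts X and Y (edges directed from X to Y) and let q be a positive integer. Define the matrix M'_H over ℚ with rows indexed by x ∈ [q]^X and columns indexed by y ∈ [q]^Y by M'_H[x,y] = ∏_{(v,w) ∈ E(H)} (x_v − y_w). Then the rank of M'_H is at most ∏_{v ∈ X} (d_{E(H)}(v) + 1). -/
/-- For a bipartite graph `H` with parts `X`, `Y` and edges `E`
directed from `X` to `Y`, the matrix `M'_H` over ℚ with rows indexed by
`x ∈ [q]^X` and columns by `y ∈ [q]^Y`, defined by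
`M'_H[x,y] = ∏_{(v,w) ∈ E} (x_v − y_w)`, has rank at most
`∏_{v ∈ X} (d_E(v) + 1)`. -/
theorem stmt_2 {X Y : Type*} [Fintype X] [Fintype Y] [DecidableEq X] [DecidableEq Y]
    (E : Finset (X × Y)) (q : ℕ) (hq : 0 < q)
    (M : Matrix (X → Fin q) (Y → Fin q) ℚ)
    (hM : ∀ x y, M x y = ∏ e ∈ E, (((x e.1 : ℕ) : ℚ) - ((y e.2 : ℕ) : ℚ))) :
    M.rank ≤ ∏ v : X, ((E.filter (fun e => e.1 = v)).card + 1) := by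
  let d : X → ℕ := fun v => (E.filter (fun e => e.1 = v)).card
  let P : X → (Y → Fin q) → Polynomial ℚ := fun v y =>
    ∏ e ∈ E.filter (fun e => e.1 = v), (Polynomial.X - Polynomial.C ((y e.2 : ℕ) : ℚ))
  have hP : ∀ v y, (P v y).natDegree < d v + 1 := fun v y => by
    simp only [P, d, Polynomial.natDegree_finsetProd_X_sub_C_eq_card]
    exact Nat.lt_succ_self _
  let A : Matrix (X → Fin q) (∀ v, Fin (d v + 1)) ℚ :=
    Matrix.of fun x k => ∏ v, ((x v : ℕ) : ℚ) ^ (k v : ℕ)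
  let B : Matrix (∀ v, Fin (d v + 1)) (Y → Fin q) ℚ :=
    Matrix.of fun k y => ∏ v, (P v y).coeff (k v)
  have hAB : M = A * B := by
    ext x y
    calc M x y = ∏ v, (P v y).eval ((x v : ℕ) : ℚ) := by
          rw [hM, ← Finset.prod_fiberwise E Prod.fst]
          refine Finset.prod_congr rfl fun v _ => ?_
          rw [Polynomial.eval_prod]
          refine Finset.prod_congr rfl fun e he => ?_
          simp [(Finset.mem_filter.mp he).2]
      _ = ∏ v, ∑ i : Fin (d v + 1), (P v y).coeff i * ((x v : ℕ) : ℚ) ^ (i : ℕ) := by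
          refine Finset.prod_congr rfl fun v _ => ?_
          rw [Polynomial.eval_eq_sum_range' (hP v y), Finset.sum_range]
      _ = (A * B) x y := by
          rw [Fintype.prod_sum, Matrix.mul_apply]
          refine Finset.sum_congr rfl fun k _ => ?_
          simp only [A, B, Matrix.of_apply]
          rw [Finset.prod_mul_distrib, mul_comm]
  rw [hAB]
  refine (Matrix.rank_mul_le_left A B).trans (A.rank_le_card_width.trans ?_)
  simp [d, Fintype.card_pi]
end

section
/- Let H be a bipartite graph with parts X and Y (edges directed from X to Y), let q be a positive integer, and let S ⊆ [q]^X. Then there exists a set S' ⊆ [q]^X that H-represents S and satisfies |S'| ≤ ∏_{v ∈ X} (d_{E(H)}(v) + 1). -/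
open Polynomial in
/-- The product over the edges of `x v - y w` is a linear combination, with coefficients depending
only on `y`, of the monomials in `x` whose degree in each variable is at most the degree of the
corresponding vertex. -/
lemma exists_edgeProd_eq_sum_monomials {V W : Type*} [Fintype V] [DecidableEq V]
    {R : Type*} [CommRing R] [Nontrivial R] (E : Finset (V × W)) (y : W → R) :
    ∃ c : (∀ v : V, Fin ((E.filter (fun e => e.1 = v)).card + 1)) → R, ∀ x : V → R,
      ∏ e ∈ E, (x e.1 - y e.2) = ∑ k, c k * ∏ v, x v ^ (k v : ℕ) := by
  let p : V → R[X] := fun v => ∏ e ∈ E.filter (fun e => e.1 = v), (X - C (y e.2))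
  have hp : ∀ v, (p v).natDegree < (E.filter (fun e => e.1 = v)).card + 1 := fun v =>
    Nat.lt_succ_of_le (natDegree_finsetProd_X_sub_C_eq_card _ _).le
  refine ⟨fun k => ∏ v, (p v).coeff (k v), fun x => ?_⟩
  calc ∏ e ∈ E, (x e.1 - y e.2) = ∏ v, (p v).eval (x v) := by
        rw [← Finset.prod_fiberwise E Prod.fst]
        refine Finset.prod_congr rfl fun v _ => ?_
        rw [eval_prod]
        refine Finset.prod_congr rfl fun e he => ?_
        simp [(Finset.mem_filter.mp he).2]
    _ = ∏ v, ∑ i : Fin ((E.filter (fun e => e.1 = v)).card + 1),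
          (p v).coeff i * x v ^ (i : ℕ) := by
        refine Finset.prod_congr rfl fun v _ => ?_
        rw [eval_eq_sum_range' (hp v), Finset.sum_range]
    _ = _ := by
        simp_rw [Finset.prod_univ_sum, Fintype.piFinset_univ, Finset.prod_mul_distrib]

/-- Any finite family of vectors has a subfamily with the same span, of size at most the
dimension of the ambient space. -/
lemma exists_subset_card_le_finrank_image_subset_span {ι K M : Type*} [Field K] [AddCommGroup M]
    [Module K M] [FiniteDimensional K M] (φ : ι → M) (S : Finset ι) :
    ∃ T ⊆ S, T.card ≤ Module.finrank K M ∧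
      φ '' (S : Set ι) ⊆ Submodule.span K (φ '' (T : Set ι)) := by
  obtain ⟨b, hbS, -, hspan, hli⟩ :=
    exists_linearIndepOn_extension (linearIndepOn_empty K φ) (Set.empty_subset (S : Set ι))
  obtain ⟨T, rfl⟩ := (S.finite_toSet.subset hbS).exists_finset_coe
  refine ⟨T, Finset.coe_subset.mp hbS, ?_, hspan⟩
  simpa using hli.linearIndependent.fintype_card_le_finrank

/-- For a bipartite graph `H` with parts `X`, `Y` and edges `E`
directed from `X` to `Y`, every set `S ⊆ [q]^X` has a subset `S'` that
`H`-represents `S` with `|S'| ≤ ∏_{v ∈ X} (d_E(v) + 1)`. -/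
theorem stmt_4 {X Y : Type*} [Fintype X] [Fintype Y] [DecidableEq X] [DecidableEq Y]
    (E : Finset (X × Y)) (q : ℕ) (hq : 0 < q) (S : Finset (X → Fin q)) :
    ∃ S' : Finset (X → Fin q),
      S' ⊆ S ∧
      (∀ y : Y → Fin q,
        (∃ x ∈ S, ∀ e ∈ E, x e.1 ≠ y e.2) ↔ (∃ x' ∈ S', ∀ e ∈ E, x' e.1 ≠ y e.2)) ∧
      S'.card ≤ ∏ v : X, ((E.filter (fun e => e.1 = v)).card + 1) := by
  let φ : (X → Fin q) → (∀ v : X, Fin ((E.filter (fun e => e.1 = v)).card + 1)) → ℚ :=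
    fun x k => ∏ v, ((x v : ℕ) : ℚ) ^ (k v : ℕ)
  obtain ⟨T, hTS, hcard, hspan⟩ :=
    exists_subset_card_le_finrank_image_subset_span (K := ℚ) φ S
  refine ⟨T, hTS, fun y => ⟨?_, fun ⟨x, hx, h⟩ => ⟨x, hTS hx, h⟩⟩, by simpa using hcard⟩
  rintro ⟨x, hx, hxy⟩
  obtain ⟨c, hc⟩ := exists_edgeProd_eq_sum_monomials E (fun w => ((y w : ℕ) : ℚ))
  let L := Fintype.linearCombination ℚ c
  have hL : ∀ x, L (φ x) ≠ 0 ↔ ∀ e ∈ E, x e.1 ≠ y e.2 := by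
    intro x
    have h : L (φ x) = ∏ e ∈ E, (((x e.1 : ℕ) : ℚ) - ((y e.2 : ℕ) : ℚ)) := by
      rw [hc fun v => ((x v : ℕ) : ℚ)]
      simp [L, φ, Fintype.linearCombination_apply, mul_comm]
    simp [h, Finset.prod_ne_zero_iff, sub_eq_zero, Fin.val_inj]
  by_contra! hT
  have hle : Submodule.span ℚ (φ '' (T : Set (X → Fin q))) ≤ LinearMap.ker L := by
    rw [Submodule.span_le]
    rintro _ ⟨x', hx', rfl⟩
    by_contra hne
    obtain ⟨e, he, heq⟩ := hT x' hx'
    exact (hL x').mp hne e he heq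
  exact (hL x).mpr hxy (hle (hspan ⟨x, hx, rfl⟩))
end

section
/- Let G be a graph with vertex set {v_1, …, v_n}, each edge directed as (v_i, v_j) with i < j, and let q be a positive integer. For each i define V_i = {v_1,…,v_i}, the cut C_i = {(v_l,v_r) ∈ E(G) : l ≤ i < r}, X_i = {v_l : (v_l,v_r) ∈ C_i}, Y_i = {v_r : (v_l,v_r) ∈ C_i}, and let H_i be the bipartite graph with parts X_i, Y_i and edge set C_i. Let T[i] ⊆ [q]^{X_i} be the set of q-colorings of X_i that extend to a proper q-coloring of the induced subgraph G[V_i]. Given T'[i−1] ⊆ [q]^{X_{i−1}}, define T'[i] = { (x ∪ (v_i, c)) restricted to X_i : x ∈ T'[i−1], c ∈ [q], and x_v ≠ c for every v ∈ N(v_i) ∩ X_{i−1} }. Then: if T'[i−1] H_{i−1}-represents T[i−1], then T'[i] H_i-represents T[i]. -/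
/-- The `i`-th cut `C_i` of the graph `G` on vertices `v_1, …, v_n` (vertex `v_k`
is the element of `Fin n` with value `k - 1`): directed edges `(v_l, v_r)` with
`l ≤ i < r` (1-based), i.e. pairs `(a, b)` with `a < b`, `G.Adj a b`,
`(a : ℕ) < i` and `i ≤ (b : ℕ)` (0-based). -/
def cutSet {n : ℕ} (G : SimpleGraph (Fin n)) [DecidableRel G.Adj] (i : ℕ) :
    Finset (Fin n × Fin n) :=
  Finset.univ.filter
    (fun e => G.Adj e.1 e.2 ∧ e.1 < e.2 ∧ (e.1 : ℕ) < i ∧ i ≤ (e.2 : ℕ))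

/-- `X_i`: the left endpoints of the edges of the `i`-th cut. -/
def leftEnds {n : ℕ} (G : SimpleGraph (Fin n)) [DecidableRel G.Adj] (i : ℕ) :
    Finset (Fin n) :=
  (cutSet G i).image Prod.fst

/-- `Y_i`: the right endpoints of the edges of the `i`-th cut. -/
def rightEnds {n : ℕ} (G : SimpleGraph (Fin n)) [DecidableRel G.Adj] (i : ℕ) :
    Finset (Fin n) :=
  (cutSet G i).image Prod.snd

/-- `x ∪ y` is a proper `q`-coloring of the bipartite graph `H_i` with parts
`X_i`, `Y_i` and edge set `C_i`. -/
def ProperCut {n : ℕ} (G : SimpleGraph (Fin n)) [DecidableRel G.Adj] (q i : ℕ)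
    (x : {v // v ∈ leftEnds G i} → Fin q) (y : {v // v ∈ rightEnds G i} → Fin q) : Prop :=
  ∀ (a b : Fin n) (h : (a, b) ∈ cutSet G i),
    x ⟨a, Finset.mem_image.mpr ⟨(a, b), h, rfl⟩⟩ ≠
    y ⟨b, Finset.mem_image.mpr ⟨(a, b), h, rfl⟩⟩

/-- `S'` `H_i`-represents `S`: `S' ⊆ S` and for every coloring `y ∈ [q]^{Y_i}`,
some `x ∈ S` together with `y` properly colors `H_i` iff some `x' ∈ S'` does. -/
def RepresentsAt {n : ℕ} (G : SimpleGraph (Fin n)) [DecidableRel G.Adj] (q i : ℕ)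
    (S' S : Set ({v // v ∈ leftEnds G i} → Fin q)) : Prop :=
  S' ⊆ S ∧ ∀ y : {v // v ∈ rightEnds G i} → Fin q,
    (∃ x ∈ S, ProperCut G q i x y) ↔ (∃ x' ∈ S', ProperCut G q i x' y)

/-- `T[i]`: the set of `q`-colorings of `X_i` that extend to a proper
`q`-coloring of the induced subgraph `G[V_i]`, where `V_i = {v_1, …, v_i}`,
i.e. the vertices with 0-based index `< i`. -/
def TSet {n : ℕ} (G : SimpleGraph (Fin n)) [DecidableRel G.Adj] (q i : ℕ) :
    Set ({v // v ∈ leftEnds G i} → Fin q) :=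
  {x | ∃ f : Fin n → Fin q,
    (∀ a b : Fin n, G.Adj a b → (a : ℕ) < i → (b : ℕ) < i → f a ≠ f b) ∧
    (∀ v : {v // v ∈ leftEnds G i}, x v = f v.1)}

/-- The update rule (4): from a set `S ⊆ [q]^{X_{i-1}}`, form
`{ (x ∪ (v_i, c))|_{X_i} : x ∈ S, c ∈ [q], x_v ≠ c for all v ∈ N(v_i) ∩ X_{i-1} }`.
Here the vertex `v_i` (1-based) is `i : Fin n` (0-based), the previous cut is
`cutSet G i` and the new cut is `cutSet G (i+1)`. -/
def NextSet {n : ℕ} (G : SimpleGraph (Fin n)) [DecidableRel G.Adj] (q : ℕ) (i : Fin n)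
    (S : Set ({v // v ∈ leftEnds G i.val} → Fin q)) :
    Set ({v // v ∈ leftEnds G (i.val + 1)} → Fin q) :=
  {z | ∃ x ∈ S, ∃ c : Fin q,
    (∀ (v : Fin n) (hv : v ∈ leftEnds G i.val), G.Adj v i → x ⟨v, hv⟩ ≠ c) ∧
    (∀ (v : Fin n) (hv : v ∈ leftEnds G (i.val + 1)),
      (v = i → z ⟨v, hv⟩ = c) ∧
      (v ≠ i → ∃ hv' : v ∈ leftEnds G i.val, z ⟨v, hv⟩ = x ⟨v, hv'⟩))}

theorem mem_cutSet {n : ℕ} {G : SimpleGraph (Fin n)} [DecidableRel G.Adj] {i : ℕ}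
    {a b : Fin n} :
    (a, b) ∈ cutSet G i ↔ G.Adj a b ∧ a < b ∧ (a : ℕ) < i ∧ i ≤ (b : ℕ) := by
  simp [cutSet]

theorem mem_leftEnds {n : ℕ} {G : SimpleGraph (Fin n)} [DecidableRel G.Adj] {i : ℕ}
    {a : Fin n} : a ∈ leftEnds G i ↔ ∃ b, (a, b) ∈ cutSet G i := by
  simp [leftEnds]

theorem mem_rightEnds {n : ℕ} {G : SimpleGraph (Fin n)} [DecidableRel G.Adj] {i : ℕ}
    {b : Fin n} : b ∈ rightEnds G i ↔ ∃ a, (a, b) ∈ cutSet G i := by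
  simp [rightEnds]

theorem mem_cutSet_succ_of_ne_right {n : ℕ} {G : SimpleGraph (Fin n)} [DecidableRel G.Adj]
    {i a b : Fin n} (h : (a, b) ∈ cutSet G i) (hb : b ≠ i) : (a, b) ∈ cutSet G (i.val + 1) := by
  rw [mem_cutSet] at h ⊢
  grind

theorem mem_cutSet_of_succ_of_ne_left {n : ℕ} {G : SimpleGraph (Fin n)} [DecidableRel G.Adj]
    {i a b : Fin n} (h : (a, b) ∈ cutSet G (i.val + 1)) (ha : a ≠ i) : (a, b) ∈ cutSet G i := by
  rw [mem_cutSet] at h ⊢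
  grind

theorem mem_leftEnds_of_succ_of_ne {n : ℕ} {G : SimpleGraph (Fin n)} [DecidableRel G.Adj]
    {i a : Fin n} (h : a ∈ leftEnds G (i.val + 1)) (ha : a ≠ i) : a ∈ leftEnds G i := by
  obtain ⟨b, hb⟩ := mem_leftEnds.1 h
  exact mem_leftEnds.2 ⟨b, mem_cutSet_of_succ_of_ne_left hb ha⟩

theorem mem_rightEnds_succ_of_ne {n : ℕ} {G : SimpleGraph (Fin n)} [DecidableRel G.Adj]
    {i b : Fin n} (h : b ∈ rightEnds G i) (hb : b ≠ i) : b ∈ rightEnds G (i.val + 1) := by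
  obtain ⟨a, ha⟩ := mem_rightEnds.1 h
  exact mem_rightEnds.2 ⟨a, mem_cutSet_succ_of_ne_right ha hb⟩

theorem mem_cutSet_of_adj_of_lt {n : ℕ} {G : SimpleGraph (Fin n)} [DecidableRel G.Adj]
    {a i : Fin n} (h : G.Adj a i) (ha : a < i) : (a, i) ∈ cutSet G i :=
  mem_cutSet.2 ⟨h, ha, ha, le_rfl⟩

theorem lt_of_mem_leftEnds {n : ℕ} {G : SimpleGraph (Fin n)} [DecidableRel G.Adj] {i : ℕ}
    {a : Fin n} (h : a ∈ leftEnds G i) : (a : ℕ) < i := by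
  obtain ⟨b, hb⟩ := mem_leftEnds.1 h
  exact (mem_cutSet.1 hb).2.2.1

theorem nextSet_subset_TSet {n q : ℕ} {G : SimpleGraph (Fin n)} [DecidableRel G.Adj]
    {i : Fin n} {S : Set ({v // v ∈ leftEnds G i.val} → Fin q)} (hS : S ⊆ TSet G q i.val) :
    NextSet G q i S ⊆ TSet G q (i.val + 1) := by
  rintro z ⟨x, hx, c, hc, hz⟩
  obtain ⟨f, hf, hxf⟩ := hS hx
  have key : ∀ a : Fin n, G.Adj a i → a < i → f a ≠ c := fun a hadj ha => by
    have hm : a ∈ leftEnds G i := mem_leftEnds.2 ⟨i, mem_cutSet_of_adj_of_lt hadj ha⟩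
    exact hxf ⟨a, hm⟩ ▸ hc a hm hadj
  refine ⟨Function.update f i c, fun a b hab ha hb => ?_, fun v => ?_⟩
  · by_cases hai : a = i
    · subst hai
      rw [Function.update_self, Function.update_of_ne hab.ne']
      exact (key b hab.symm (by grind [hab.ne])).symm
    · by_cases hbi : b = i
      · subst hbi
        rw [Function.update_self, Function.update_of_ne hai]
        exact key a hab (by grind)
      · rw [Function.update_of_ne hai, Function.update_of_ne hbi]
        exact hf a b hab (by grind) (by grind)
  · obtain ⟨v, hv⟩ := v
    by_cases hvi : v = i
    · subst hvi
      simpa using (hz v hv).1 rfl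
    · obtain ⟨hv', h⟩ := (hz v hv).2 hvi
      rw [h, hxf, Function.update_of_ne hvi]

/-- If `T'[i-1]` `H_{i-1}`-represents `T[i-1]`, then the set
`T'[i]` obtained by the update rule (4) `H_i`-represents `T[i]`. -/
theorem stmt_6 {n q : ℕ} (hq : 0 < q) (G : SimpleGraph (Fin n)) [DecidableRel G.Adj]
    (i : Fin n) (T' : Set ({v // v ∈ leftEnds G i.val} → Fin q))
    (h : RepresentsAt G q i.val T' (TSet G q i.val)) :
    RepresentsAt G q (i.val + 1) (NextSet G q i T') (TSet G q (i.val + 1)) := by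
  refine ⟨nextSet_subset_TSet h.1, fun y => ⟨?_, fun ⟨x, hx, hxy⟩ =>
    ⟨x, nextSet_subset_TSet h.1 hx, hxy⟩⟩⟩
  rintro ⟨x, ⟨f, hf, hxf⟩, hxy⟩
  let y₀ : {v // v ∈ rightEnds G i.val} → Fin q := fun b =>
    if hb : b.1 = i then f i else y ⟨b.1, mem_rightEnds_succ_of_ne b.2 hb⟩
  obtain ⟨x', hx', hxy'⟩ := (h.2 y₀).1 ⟨fun v => f v.1,
    ⟨f, fun a b hab ha hb => hf a b hab (by omega) (by omega), fun _ => rfl⟩, fun a b hab => by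
      by_cases hb : b = i
      · subst hb
        have := mem_cutSet.1 hab
        simpa [y₀] using hf a b this.1 (by omega) (by omega)
      · simpa [y₀, hb, hxf] using hxy a b (mem_cutSet_succ_of_ne_right hab hb)⟩
  refine ⟨fun v => if hv : v.1 = i then f i else x' ⟨v.1, mem_leftEnds_of_succ_of_ne v.2 hv⟩,
    ⟨x', hx', f i, fun v hv hadj => ?_, fun v hv => ⟨fun hvi => by simp [hvi], fun hvi =>
      ⟨mem_leftEnds_of_succ_of_ne hv hvi, by simp [hvi]⟩⟩⟩, fun a b hab => ?_⟩
  · simpa [y₀] using hxy' v i (mem_cutSet_of_adj_of_lt hadj (lt_of_mem_leftEnds hv))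
  · by_cases ha : a = i
    · subst ha
      simpa [hxf] using hxy a b hab
    · have hb : b ≠ i := by
        have := mem_cutSet.1 hab
        grind
      simpa [y₀, ha, hb] using hxy' a b (mem_cutSet_of_succ_of_ne_left hab ha)
end

section
/- (Isolation Lemma) Let F ⊆ 2^U be a nonempty family of subsets of a finite universe U, and let W be a positive integer. If for each u ∈ U a weight ω(u) ∈ {1, 2, …, W} is chosen uniformly and independently at random, then the probability that ω isolates F is at least 1 − |U| / W. -/
/-- `S` is a member of `F` of minimum weight. -/
def IsMinWeight {U : Type*} (F : Finset (Finset U)) (w : U → ℕ) (S : Finset U) : Prop :=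
  S ∈ F ∧ ∀ T ∈ F, ∑ u ∈ S, w u ≤ ∑ u ∈ T, w u

/-- Some minimum-weight members of `F` contain `u` and some do not. -/
def IsTiedAt {U : Type*} (F : Finset (Finset U)) (w : U → ℕ) (u : U) : Prop :=
  ∃ S T, IsMinWeight F w S ∧ IsMinWeight F w T ∧ u ∈ S ∧ u ∉ T

theorem exists_isMinWeight {U : Type*} {F : Finset (Finset U)} (hF : F.Nonempty) (w : U → ℕ) :
    ∃ S, IsMinWeight F w S :=
  F.exists_min_image (fun S => ∑ u ∈ S, w u) hF

theorem existsUnique_isMinWeight_of_forall_not_isTiedAt {U : Type*} {F : Finset (Finset U)}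
    (hF : F.Nonempty) {w : U → ℕ} (h : ∀ u, ¬ IsTiedAt F w u) : ∃! S, IsMinWeight F w S := by
  obtain ⟨S, hS⟩ := exists_isMinWeight hF w
  refine ⟨S, hS, fun T hT => Finset.ext fun u => ⟨fun hu => ?_, fun hu => ?_⟩⟩
  · by_contra hn
    exact h u ⟨T, S, hT, hS, hu, hn⟩
  · by_contra hn
    exact h u ⟨S, T, hS, hT, hu, hn⟩

/-- If two weights agree away from `u` and both have a tie at `u`, then the second is at most
the first at `u` (and so, by symmetry, they agree there). -/
theorem IsTiedAt.le_of_agree {U : Type*} {F : Finset (Finset U)} {w w' : U → ℕ} {u : U}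
    (h : IsTiedAt F w u) (h' : IsTiedAt F w' u) (hagree : ∀ v, v ≠ u → w v = w' v) :
    w' u ≤ w u := by
  obtain ⟨-, T, -, hT, -, huT⟩ := h
  obtain ⟨S, -, hS, -, huS, -⟩ := h'
  by_contra! hlt
  have hST : ∑ v ∈ S, w v < ∑ v ∈ S, w' v := by
    refine Finset.sum_lt_sum (fun v _ => ?_) ⟨u, huS, hlt⟩
    by_cases hv : v = u
    · exact hv ▸ hlt.le
    · exact (hagree v hv).le
  have hTT : ∑ v ∈ T, w v = ∑ v ∈ T, w' v :=
    Finset.sum_congr rfl fun v hv => hagree v fun h => huT (h ▸ hv)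
  have := hS.2 T hT.1
  have := hT.2 S hS.1
  omega

open Classical in
/-- A tie at a given `u` has probability at most `1 / W`. -/
theorem card_isTiedAt_mul_le {U : Type*} [Fintype U] (F : Finset (Finset U)) (W : ℕ) (u : U) :
    (Finset.univ.filter fun f : U → Fin W => IsTiedAt F (fun v => (f v : ℕ) + 1) u).card * W ≤
      W ^ Fintype.card U := by
  have hinj : Set.InjOn (fun p : (U → Fin W) × Fin W => Function.update p.1 u p.2)
      ((Finset.univ.filter fun f : U → Fin W => IsTiedAt F (fun v => (f v : ℕ) + 1) u) ×ˢ
        (Finset.univ : Finset (Fin W)) : Finset _) := by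
    rintro ⟨f, c⟩ hf ⟨g, d⟩ hg hfg
    simp only [Finset.coe_product, Set.mem_prod, Finset.mem_coe, Finset.mem_filter,
      Finset.mem_univ, true_and, and_true] at hf hg hfg
    have hcd : c = d := by simpa using congrFun hfg u
    have hoff : ∀ v, v ≠ u → f v = g v := fun v hv => by simpa [hv] using congrFun hfg v
    have hle := hf.le_of_agree hg fun v hv => by simp only [hoff v hv]
    have hge := hg.le_of_agree hf fun v hv => by simp only [hoff v hv]
    refine Prod.ext (funext fun v => ?_) hcd
    by_cases hv : v = u
    · subst hv
      exact Fin.ext (Nat.succ_injective (hge.antisymm hle))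
    · exact hoff v hv
  simpa using Finset.card_le_card_of_injOn _ (fun _ _ => Finset.mem_univ _) hinj

open Classical in
/-- Union bound: every weight either isolates `F` or has a tie at some `u`. -/
theorem card_le_card_existsUnique_add_sum {U : Type*} [Fintype U] {F : Finset (Finset U)}
    (hF : F.Nonempty) (W : ℕ) :
    W ^ Fintype.card U ≤
      Nat.card {f : U → Fin W // ∃! S, IsMinWeight F (fun v => (f v : ℕ) + 1) S} +
        ∑ u, (Finset.univ.filter fun f : U → Fin W =>
          IsTiedAt F (fun v => (f v : ℕ) + 1) u).card := by
  rw [Nat.card_eq_fintype_card, Fintype.card_subtype]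
  have hcover : (Finset.univ : Finset (U → Fin W)) ⊆
      Finset.filter (fun f => ∃! S, IsMinWeight F (fun v => (f v : ℕ) + 1) S) Finset.univ ∪
        Finset.univ.biUnion fun u =>
          Finset.filter (fun f => IsTiedAt F (fun v => (f v : ℕ) + 1) u) Finset.univ := by
    intro f _
    by_cases h : ∃ u, IsTiedAt F (fun v => (f v : ℕ) + 1) u
    · simp [h]
    · simp [existsUnique_isMinWeight_of_forall_not_isTiedAt hF (not_exists.mp h)]
  calc W ^ Fintype.card U = (Finset.univ : Finset (U → Fin W)).card := by simp
    _ ≤ _ := Finset.card_le_card hcover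
    _ ≤ _ := Finset.card_union_le _ _
    _ ≤ _ := Nat.add_le_add_left Finset.card_biUnion_le _

/-- **Isolation Lemma.** Let `F` be a nonempty family of subsets
of a finite universe `U` and `W` a positive integer. Choosing each weight
`ω(u) ∈ {1, …, W}` uniformly and independently at random (modelled by a uniform
random `f : U → Fin W`, with `ω(u) = f(u) + 1`), the probability that `ω`
isolates `F` — i.e. there is a unique `S' ∈ F` of minimum weight
`ω(S') = Σ_{u ∈ S'} ω(u)` — is at least `1 − |U| / W`. -/
theorem stmt_13 {U : Type*} [Fintype U] [DecidableEq U]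
    (F : Finset (Finset U)) (hF : F.Nonempty) (W : ℕ) (hW : 0 < W) :
    (1 : ℚ) - (Fintype.card U : ℚ) / (W : ℚ) ≤
      (Nat.card {f : U → Fin W //
          ∃! S : Finset U, S ∈ F ∧
            ∀ T ∈ F, (∑ u ∈ S, ((f u : ℕ) + 1)) ≤ ∑ u ∈ T, ((f u : ℕ) + 1)} : ℚ) /
        (Fintype.card (U → Fin W) : ℚ) := by
  classical
  change _ ≤ (Nat.card {f : U → Fin W // ∃! S, IsMinWeight F (fun v => (f v : ℕ) + 1) S} : ℚ) / _
  have hW' : (0 : ℚ) < W := by exact_mod_cast hW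
  have hbad := Finset.sum_le_sum fun u (_ : u ∈ Finset.univ) => card_isTiedAt_mul_le F W u
  rw [← Finset.sum_mul, Finset.sum_const, Finset.card_univ, smul_eq_mul] at hbad
  have hgood := card_le_card_existsUnique_add_sum hF W
  rw [Fintype.card_fun, Fintype.card_fin, le_div_iff₀ (by exact_mod_cast pow_pos hW _),
    ← mul_le_mul_iff_left₀ hW', one_sub_div hW'.ne']
  have hkey := Nat.mul_le_mul_right W hgood
  rw [add_mul] at hkey
  have hnat := hkey.trans (Nat.add_le_add_left hbad _)
  have hrat := (Nat.cast_le (α := ℚ)).mpr hnat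
  push_cast at hrat ⊢
  rw [mul_right_comm, div_mul_cancel₀ _ hW'.ne']
  linarith
end

section
/- Let q ≥ 2 and t ≥ 1, and let G be a t-chain of q-cliques, i.e., G consists of t vertex-disjoint cliques Z_1, …, Z_t of size q, each with a distinguished terminal vertex z_i ∈ Z_i, together with, for each i ∈ [t−1], edges joining z_{i+1} to the q−1 non-terminal vertices of Z_i. Then in every proper q-coloring of G, all terminal vertices z_1, …, z_t receive the same color. -/
/-- Let `G` be a `t`-chain of `q`-cliques (`q ≥ 2`, `t ≥ 1`):
vertex-disjoint cliques `Z_0, …, Z_{t-1}` of size `q` with distinguished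
terminals `z_i ∈ Z_i`, where for consecutive indices the terminal `z_{i+1}` is
adjacent to the `q − 1` non-terminal vertices of `Z_i`, and these are all the
edges of `G`. Then every proper `q`-coloring of `G` assigns all terminals the
same color. -/
theorem stmt_16 {V : Type*} [DecidableEq V] (q t : ℕ) (hq : 2 ≤ q) (ht : 1 ≤ t)
    (G : SimpleGraph V) (Z : Fin t → Finset V) (z : Fin t → V)
    (hdisj : ∀ i j : Fin t, i ≠ j → Disjoint (Z i) (Z j))
    (hcard : ∀ i : Fin t, (Z i).card = q)
    (hz : ∀ i : Fin t, z i ∈ Z i)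
    (hadj : ∀ a b : V, G.Adj a b ↔
      ((∃ i : Fin t, a ∈ Z i ∧ b ∈ Z i ∧ a ≠ b) ∨
       (∃ i j : Fin t, (j : ℕ) = (i : ℕ) + 1 ∧
         ((a = z j ∧ b ∈ Z i ∧ b ≠ z i) ∨ (b = z j ∧ a ∈ Z i ∧ a ≠ z i)))))
    (f : V → Fin q) (hf : ∀ a b : V, G.Adj a b → f a ≠ f b)
    (i j : Fin t) : f (z i) = f (z j) := by
  have hstep : ∀ i j : Fin t, (j : ℕ) = (i : ℕ) + 1 → f (z j) = f (z i) := by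
    intro i j hij
    have hinj : Set.InjOn f (Z i : Set V) := by
      intro a ha b hb hab
      by_contra hne
      exact hf a b ((hadj a b).2 (Or.inl ⟨i, ha, hb, hne⟩)) hab
    have himage : (Z i).image f = Finset.univ :=
      Finset.eq_univ_of_card _ (by
        rw [Finset.card_image_of_injOn hinj, hcard, Fintype.card_fin])
    obtain ⟨b, hb, hfb⟩ := Finset.mem_image.1 (himage ▸ Finset.mem_univ (f (z j)))
    by_cases hbz : b = z i
    · rw [← hfb, hbz]
    · exact absurd hfb.symm
        (hf _ _ ((hadj (z j) b).2 (Or.inr ⟨i, j, hij, Or.inl ⟨rfl, hb, hbz⟩⟩)))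
  have hfirst : ∀ (n : ℕ) (hn : n < t), f (z ⟨n, hn⟩) = f (z ⟨0, ht⟩) := by
    intro n
    induction n with
    | zero => exact fun _ => rfl
    | succ n ih =>
      exact fun hn => (hstep ⟨n, by omega⟩ ⟨n + 1, hn⟩ rfl).trans (ih (by omega))
  exact (hfirst i i.2).trans (hfirst j j.2).symm
end

section
/- Let ℓ ≥ 1 and let P be a path with 2ℓ vertices a_1, b_1, a_2, b_2, …, a_ℓ, b_ℓ in this order (consecutive vertices adjacent). Define lists L(a_1) = {2,3}, L(a_k) = {1,2,3} for 2 ≤ k ≤ ℓ, L(b_k) = {1,2} for 1 ≤ k ≤ ℓ−1, and L(b_ℓ) = {2}. Then every proper coloring f of P with f(v) ∈ L(v) for all vertices v assigns color 3 to at least one vertex (necessarily one of the a-vertices). -/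
/-- Let `P` be a path with `2ℓ` vertices
`a_1, b_1, a_2, b_2, …, a_ℓ, b_ℓ` in this order (modelled on `Fin (2ℓ)`, where
index `2k` is `a_{k+1}` and index `2k+1` is `b_{k+1}`), with lists
`L(a_1) = {2,3}`, `L(a_k) = {1,2,3}` for `2 ≤ k ≤ ℓ`, `L(b_k) = {1,2}` for
`1 ≤ k ≤ ℓ−1` and `L(b_ℓ) = {2}`. Then every proper list coloring `f` of `P`
assigns color `3` to at least one vertex, necessarily an `a`-vertex. -/
theorem stmt_18 (l : ℕ) (hl : 1 ≤ l) (f : Fin (2 * l) → ℕ)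
    (hproper : ∀ (i : ℕ) (h : i + 1 < 2 * l),
      f ⟨i, by omega⟩ ≠ f ⟨i + 1, h⟩)
    (hcolors : ∀ v : Fin (2 * l), f v ∈ ({1, 2, 3} : Set ℕ))
    (ha1 : f ⟨0, by omega⟩ ∈ ({2, 3} : Set ℕ))
    (hb : ∀ (k : ℕ) (hk : k < l - 1), f ⟨2 * k + 1, by omega⟩ ∈ ({1, 2} : Set ℕ))
    (hblast : f ⟨2 * l - 1, by omega⟩ = 2) :
    ∃ v : Fin (2 * l), (v : ℕ) % 2 = 0 ∧ f v = 3 := by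
  by_contra! hno
  simp only [Set.mem_insert_iff, Set.mem_singleton_iff] at hcolors ha1 hb
  have ha : ∀ (k : ℕ) (hk : k < l), f ⟨2 * k, by omega⟩ = 2 := by
    intro k
    induction k with
    | zero =>
      intro _
      exact ha1.resolve_right (hno ⟨0, by omega⟩ rfl)
    | succ k ih =>
      intro hk
      have hak := ih (by omega)
      have hbk := hb k (by omega)
      have hab := hproper (2 * k) (by omega)
      have hba : f ⟨2 * k + 1, by omega⟩ ≠ f ⟨2 * (k + 1), by omega⟩ :=
        hproper (2 * k + 1) (by omega)
      have hcol := hcolors ⟨2 * (k + 1), by omega⟩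
      have hne := hno ⟨2 * (k + 1), by omega⟩ (Nat.mul_mod_right 2 (k + 1))
      omega
  obtain ⟨m, rfl⟩ := Nat.exists_eq_add_of_le' hl
  exact hproper (2 * m) (by omega) ((ha m (by omega)).trans hblast.symm)
end
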